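/- For every integer ℓ ≥ 4 there exists a constant c_ℓ such that every finite C_{ℓ+1}-free simple graph G with at least one vertex and chromatic number χ satisfies φ(G) ≥ χ − 8ℓ²·ln(ln(χ)) − c_ℓ (as an inequality of real numbers, for χ large enough that ln ln χ is defined, or with the convention that the right-hand side is ≤ 0 otherwise). -/

import Mathlib

open SimpleGraph

/-- `σ` is a proper colouring of `G` with colours in `ℕ`. -/
def IsProperColoring {V : Type*} (G : SimpleGraph V) (σ : V → ℕ) : Prop :=
  ∀ ⦃u v : V⦄, G.Adj u v → σ u ≠ σ v

/-- The chromatic number of `G`, as a natural number. -/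
noncomputable def chromNum {V : Type*} (G : SimpleGraph V) : ℕ :=
  sInf {n : ℕ | G.Colorable n}

/-- The discrepancy `φ_σ(G)` of a proper colouring `σ` of `G`: the maximum, over all
induced subgraphs `G[S]` of `G`, of `|σ(S)| - χ(G[S])`. -/
noncomputable def colDisc {V : Type*} (G : SimpleGraph V) (σ : V → ℕ) : ℤ :=
  sSup {z : ℤ | ∃ S : Set V, z = ((σ '' S).ncard : ℤ) - (chromNum (G.induce S) : ℤ)}

/-- The chromatic discrepancy `φ(G)`: the minimum of `φ_σ(G)` over all proper
colourings `σ` of `G`. -/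
noncomputable def chromDisc {V : Type*} (G : SimpleGraph V) : ℤ :=
  sInf {z : ℤ | ∃ σ : V → ℕ, IsProperColoring G σ ∧ z = colDisc G σ}

/-- `G` is locally `s`-colourable: the closed neighbourhood of every vertex induces an
`s`-colourable subgraph. -/
def LocallyColorable {V : Type*} (G : SimpleGraph V) (s : ℕ) : Prop :=
  ∀ v : V, chromNum (G.induce (insert v (G.neighborSet v))) ≤ s

/-- The set of vertices at distance at most `r` from `v` in `G`. -/
def ballSet {V : Type*} (G : SimpleGraph V) (v : V) (r : ℕ) : Set V :=
  {u : V | ∃ w : G.Walk v u, w.length ≤ r}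

/-- `G` is `r`-locally `s`-colourable: every ball of radius `r` induces an
`s`-colourable subgraph. -/
def RLocallyColorable {V : Type*} (G : SimpleGraph V) (r s : ℕ) : Prop :=
  ∀ v : V, chromNum (G.induce (ballSet G v r)) ≤ s

/-- `G` contains no cycle of length exactly `n` as a (not necessarily induced) subgraph. -/
def CycleLenFree {V : Type*} (G : SimpleGraph V) (n : ℕ) : Prop :=
  ∀ (v : V) (w : G.Walk v v), w.IsCycle → w.length ≠ n

/-- `H` is `k`-degenerate: every non-empty (induced) subgraph contains a vertex of
degree at most `k` in it. -/
def Degenerate {α : Type*} (H : SimpleGraph α) (k : ℕ) : Prop :=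
  ∀ S : Set α, S.Nonempty → ∃ a ∈ S, {b | b ∈ S ∧ H.Adj a b}.ncard ≤ k

/-- `G` is co-locally `s`-colourable: for all vertices `u ≠ v`,
`χ(G[{u} ∪ N(v)]) ≤ s`. -/
def CoLocallyColorable {V : Type*} (G : SimpleGraph V) (s : ℕ) : Prop :=
  ∀ v u : V, u ≠ v → chromNum (G.induce (insert u (G.neighborSet v))) ≤ s

/-- The minimum of `χ(G[X])` over all subsets `X ⊆ V(G)` spanning exactly `p` colours
of `σ` (a rainbow cover of `σ` when `σ` uses exactly `p` colours). -/
noncomputable def minRainbowChrom {V : Type*} (G : SimpleGraph V) (σ : V → ℕ) (p : ℕ) : ℕ :=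
  sInf {c : ℕ | ∃ X : Set V, (σ '' X).ncard = p ∧ c = chromNum (G.induce X)}

/-- `f_G(p)`: the maximum, over all proper colourings `σ` of `G` using exactly `p`
colours, of the minimum chromatic number of a rainbow cover of `σ`. -/
noncomputable def fG {V : Type*} (G : SimpleGraph V) (p : ℕ) : ℕ :=
  sSup {m : ℕ | ∃ σ : V → ℕ, IsProperColoring G σ ∧ (σ '' Set.univ).ncard = p ∧
    m = minRainbowChrom G σ p}

/-- The closed neighbourhood `N[X]` of a set `X` of vertices. -/
def closedNbhd {V : Type*} (G : SimpleGraph V) (X : Set V) : Set V :=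
  X ∪ {u : V | ∃ x ∈ X, G.Adj x u}


/-- `G[W]` is properly colourable with `n` colours. -/
def ColS {V : Type} (G : SimpleGraph V) (W : Set V) (n : ℕ) : Prop :=
  ∃ c : V → ℕ, (∀ v ∈ W, c v < n) ∧ ∀ u ∈ W, ∀ v ∈ W, G.Adj u v → c u ≠ c v

section basics
variable {V : Type} {G : SimpleGraph V}

lemma ColS.mono {W W' : Set V} {n n' : ℕ} (h : ColS G W n) (hW : W' ⊆ W) (hn : n ≤ n') :
    ColS G W' n' := by
  obtain ⟨c, h1, h2⟩ := h
  exact ⟨c, fun v hv => (h1 v (hW hv)).trans_le hn, fun u hu v hv => h2 u (hW hu) v (hW hv)⟩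

lemma ColS.of_fintype {W : Set V} {γ : Type} [Fintype γ] (n : ℕ) (hn : Fintype.card γ ≤ n)
    (c : V → γ) (h : ∀ u ∈ W, ∀ v ∈ W, G.Adj u v → c u ≠ c v) : ColS G W n := by
  refine ⟨fun v => (Fintype.equivFin γ (c v) : ℕ), fun v _ => (Fin.is_lt _).trans_le hn, ?_⟩
  intro u hu v hv ha he
  exact h u hu v hv ha ((Fintype.equivFin γ).injective (Fin.ext he))

lemma ColS.union {A B : Set V} {a b : ℕ} (hA : ColS G A a) (hB : ColS G B b) :
    ColS G (A ∪ B) (a + b) := by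
  classical
  obtain ⟨c, h1, h2⟩ := hA
  obtain ⟨e, h3, h4⟩ := hB
  refine ⟨fun v => if v ∈ A then c v else a + e v, ?_, ?_⟩
  · intro v hv
    by_cases h : v ∈ A
    · simp only [h, if_true]; have := h1 v h; omega
    · have hb : v ∈ B := hv.resolve_left h
      simp only [h, if_false]; have := h3 v hb; omega
  · intro u hu v hv ha
    by_cases h : u ∈ A <;> by_cases h' : v ∈ A <;> simp only [h, h', if_true, if_false]
    · exact h2 u h v h' ha
    · have := h1 u h; omega
    · have := h1 v h'; omega
    · have := h4 u (hu.resolve_left h) v (hv.resolve_left h') ha; omega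

lemma ColS.empty : ColS G ∅ 0 := ⟨fun _ => 0, by simp, by simp⟩

lemma ColS.biUnion {b : ℕ} (S : V → Set V) (hS : ∀ x, ColS G (S x) b) (X : Finset V) :
    ColS G {u | ∃ x ∈ X, u ∈ S x} (X.card * b) := by
  classical
  induction X using Finset.induction_on with
  | empty => exact (ColS.empty (G := G)).mono (by intro u; simp) (by simp)
  | insert a s ha ih =>
    refine ((hS a).union ih).mono ?_ ?_
    · rintro u ⟨x, hx, hu⟩
      rcases Finset.mem_insert.1 hx with rfl | hx
      · exact Or.inl hu
      · exact Or.inr ⟨x, hx, hu⟩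
    · rw [Finset.card_insert_of_notMem ha]; ring_nf; rfl

lemma ColS.of_proper {σ : V → ℕ} (hσ : IsProperColoring G σ) (C : Finset ℕ) {W : Set V}
    (hW : ∀ v ∈ W, σ v ∈ C) : ColS G W C.card := by
  classical
  rcases W.eq_empty_or_nonempty with rfl | ⟨w, hw⟩
  · exact ColS.empty.mono le_rfl (Nat.zero_le _)
  refine ColS.of_fintype (γ := C) _ (by simp)
    (fun v => if h : v ∈ W then ⟨σ v, hW v h⟩ else ⟨σ w, hW w hw⟩) ?_
  intro u hu v hv ha
  simp only [hu, hv, dif_pos]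
  intro h
  exact hσ ha (congrArg Subtype.val h)

lemma chromNum_induce_le [Finite V] {W : Set V} {n : ℕ} :
    chromNum (G.induce W) ≤ n ↔ ColS G W n := by
  classical
  have key : ∀ m, (G.induce W).Colorable m ↔ ColS G W m := by
    intro m
    constructor
    · rintro ⟨C⟩
      refine ⟨fun v => if h : v ∈ W then (C ⟨v, h⟩ : ℕ) else 0, ?_, ?_⟩
      · intro v hv; simp [hv]
      · intro u hu v hv ha he
        simp only [hu, hv, dif_pos] at he
        exact C.valid (v := ⟨u, hu⟩) (w := ⟨v, hv⟩) ha (Fin.ext he)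
    · rintro ⟨c, h1, h2⟩
      refine ⟨Coloring.mk (fun v => ⟨c v, h1 v v.2⟩) ?_⟩
      intro u v ha he
      exact h2 u u.2 v v.2 ha (congrArg Fin.val he)
  have hne : ∃ m, (G.induce W).Colorable m := by
    have := Fintype.ofFinite V
    exact ⟨_, (G.induce W).colorable_of_fintype⟩
  constructor
  · intro h
    have := Nat.sInf_mem (s := {n : ℕ | (G.induce W).Colorable n}) hne
    exact ((key _).1 this).mono le_rfl h
  · intro h
    exact Nat.sInf_le ((key n).2 h)

lemma chromNum_le_univ [Finite V] : chromNum G ≤ chromNum (G.induce (Set.univ : Set V)) := by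
  obtain ⟨c, h1, h2⟩ := (chromNum_induce_le (G := G) (W := Set.univ)).1 le_rfl
  refine Nat.sInf_le ⟨Coloring.mk (fun v => ⟨c v, h1 v trivial⟩) ?_⟩
  intro u v ha he
  exact h2 u trivial v trivial ha (congrArg Fin.val he)

end basics

section GallaiRoy
variable {V : Type}

/-- there is an increasing path with `j` edges in `W` ending at `u` -/
def IncTo (G : SimpleGraph V) (W : Set V) (ρ : V → ℕ) : ℕ → V → V → Prop
  | 0, w, u => u ∈ W ∧ w = u
  | (j+1), w, u => u ∈ W ∧ ∃ z, IncTo G W ρ j w z ∧ G.Adj z u ∧ ρ z < ρ u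

variable {G : SimpleGraph V} {W : Set V} {ρ : V → ℕ}

lemma gallaiRoy {k : ℕ} (hk : ∀ w u, ¬ IncTo G W ρ k w u) :
    ∃ c : V → ℕ, (∀ v ∈ W, c v < k) ∧
      ∀ u ∈ W, ∀ v ∈ W, G.Adj u v → ρ u ≠ ρ v → c u ≠ c v := by
  classical
  rcases k with _ | k
  · exact ⟨fun _ => 0, fun v hv => absurd ⟨hv, rfl⟩ (hk v v), fun v hv => absurd ⟨hv, rfl⟩ (hk v v)⟩
  let c : V → ℕ := fun v => Nat.findGreatest (fun j => ∃ w, IncTo G W ρ j w v) k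
  have hc : ∀ v ∈ W, ∃ w, IncTo G W ρ (c v) w v := fun v hv =>
    Nat.findGreatest_spec (P := fun j => ∃ w, IncTo G W ρ j w v) (Nat.zero_le k) ⟨v, hv, rfl⟩
  have hlt : ∀ u ∈ W, ∀ v ∈ W, G.Adj u v → ρ u < ρ v → c u < c v := by
    intro u hu v hv ha hr
    obtain ⟨w, hw⟩ := hc u hu
    have h1 : IncTo G W ρ (c u + 1) w v := ⟨hv, u, hw, ha, hr⟩
    have hle : c u ≤ k := Nat.findGreatest_le k
    have h2 : c u + 1 ≤ k := by
      rcases hle.lt_or_eq with h | h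
      · exact h
      · rw [h] at h1; exact absurd h1 (hk w v)
    exact Nat.le_findGreatest (P := fun j => ∃ w, IncTo G W ρ j w v) h2 ⟨w, h1⟩
  refine ⟨c, fun v _ => Nat.lt_succ_of_le (Nat.findGreatest_le k), ?_⟩
  intro u hu v hv ha hr
  rcases lt_or_gt_of_ne hr with h | h
  · exact (hlt u hu v hv ha h).ne
  · exact (hlt v hv u hu ha.symm h).ne'

lemma IncTo.walk {j : ℕ} {w u : V} (h : IncTo G W ρ j w u) :
    ∃ p : G.Walk w u, p.IsPath ∧ p.length = j ∧ (∀ z ∈ p.support, z ∈ W ∧ ρ z ≤ ρ u) ∧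
      (0 < j → ρ w < ρ u) := by
  induction j generalizing u with
  | zero =>
    obtain ⟨hu, rfl⟩ := h
    exact ⟨Walk.nil, by simp, by simp, by simpa using hu, by simp⟩
  | succ j ih =>
    obtain ⟨hu, z, hz, ha, hr⟩ := h
    obtain ⟨p, hp, hl, hs, hj⟩ := ih hz
    refine ⟨p.concat ha, ?_, by simp [hl], ?_, ?_⟩
    · refine hp.concat ?_ ha
      intro hmem
      have := (hs u hmem).2
      omega
    · intro y hy
      rw [Walk.support_concat] at hy
      simp only [List.concat_eq_append, List.mem_append, List.mem_singleton] at hy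
      rcases hy with hy | rfl
      · have := hs y hy; exact ⟨this.1, by omega⟩
      · exact ⟨hu, le_rfl⟩
    · intro _
      exact ((hs w p.start_mem_support).2).trans_lt hr

end GallaiRoy

section cyc
variable {V : Type} {G : SimpleGraph V} {ℓ : ℕ}

lemma no_path (hG : CycleLenFree G (ℓ + 1)) (hℓ : 4 ≤ ℓ) {v u w : V} (p : G.Walk u w)
    (hp : p.IsPath) (hl : p.length + 1 = ℓ) (hv : v ∉ p.support) (h1 : G.Adj v u)
    (h2 : G.Adj w v) : False := by
  have hq : (p.concat h2).IsPath := hp.concat hv h2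
  refine hG v (Walk.cons h1 (p.concat h2)) ?_ (by simp; omega)
  rw [Walk.cons_isCycle_iff]
  refine ⟨hq, ?_⟩
  rw [Walk.edges_concat]
  simp only [List.concat_eq_append, List.mem_append, List.mem_singleton, not_or]
  refine ⟨fun h => hv (Walk.fst_mem_support_of_mem_edges p h), ?_⟩
  intro h
  have huw : u = w := by
    simp only [Sym2.eq_iff] at h
    rcases h with ⟨h, _⟩ | ⟨_, h⟩
    · exact absurd (h ▸ p.end_mem_support) hv
    · exact h
  subst huw
  rw [Walk.isPath_iff_eq_nil] at hp
  subst hp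
  simp at hl; omega

lemma nbhd_col [Finite V] (hG : CycleLenFree G (ℓ + 1)) (hℓ : 4 ≤ ℓ) (v : V) :
    ColS G (G.neighborSet v) ℓ := by
  obtain ⟨ρ, hρ⟩ := Countable.exists_injective_nat V
  obtain ⟨c, h1, h2⟩ := gallaiRoy (G := G) (W := G.neighborSet v) (ρ := ρ) (k := ℓ - 1) (by
    intro w u h
    obtain ⟨p, hp, hl, hs, -⟩ := h.walk
    refine no_path hG hℓ p hp (by omega) (v := v) ?_ ?_ ?_
    · intro hm; exact G.loopless.irrefl v (hs v hm).1
    · exact (hs w p.start_mem_support).1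
    · exact ((hs u p.end_mem_support).1).symm)
  exact ⟨c, fun x hx => by have := h1 x hx; omega,
    fun a ha b hb hab => h2 a ha b hb hab (fun h => hab.ne (hρ h))⟩

/-- second neighbourhood -/
def L2 (G : SimpleGraph V) (x : V) : Set V :=
  {u | u ≠ x ∧ ¬ G.Adj x u ∧ ∃ a, G.Adj x a ∧ G.Adj a u}

lemma L2_col [Finite V] (hG : CycleLenFree G (ℓ + 1)) (hℓ : 4 ≤ ℓ) (x : V) :
    ColS G (L2 G x) (ℓ * ℓ) := by
  classical
  obtain ⟨e, he⟩ := Countable.exists_injective_nat V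
  have hpar : ∀ u, ∃ a, u ∈ L2 G x → G.Adj x a ∧ G.Adj a u := by
    intro u
    by_cases h : u ∈ L2 G x
    · obtain ⟨a, ha⟩ := h.2.2; exact ⟨a, fun _ => ha⟩
    · exact ⟨x, fun h' => absurd h' h⟩
  choose π hπ using hpar
  obtain ⟨c, h1, h2⟩ := gallaiRoy (G := G) (W := L2 G x) (ρ := fun u => e (π u)) (k := ℓ - 3) (by
    intro w u h
    obtain ⟨p, hp, hl, hs, hj⟩ := h.walk
    have hw := (hs w p.start_mem_support).1
    have hu := (hs u p.end_mem_support).1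
    have hne : π w ≠ π u := fun h => by
      have := hj (by omega)
      simp [h] at this
    have hnp : ∀ a, G.Adj x a → a ∉ p.support := fun a ha hm => (hs a hm).1.2.1 ha
    have hq : (p.concat (hπ u hu).2.symm).IsPath := hp.concat (hnp _ (hπ u hu).1) _
    have hq2 : (Walk.cons (hπ w hw).2 (p.concat (hπ u hu).2.symm)).IsPath := by
      rw [Walk.cons_isPath_iff]
      refine ⟨hq, ?_⟩
      rw [Walk.support_concat]
      simp only [List.concat_eq_append, List.mem_append, List.mem_singleton, not_or]
      exact ⟨hnp _ (hπ w hw).1, hne⟩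
    refine no_path hG hℓ _ hq2 (by simp; omega) (v := x) ?_ (hπ w hw).1 (hπ u hu).1.symm
    rw [Walk.support_cons, Walk.support_concat]
    simp only [List.concat_eq_append, List.mem_append, List.mem_singleton, List.mem_cons, not_or]
    exact ⟨(hπ w hw).1.ne, fun hm => (hs x hm).1.1 rfl, (hπ u hu).1.ne, by simp⟩)
  choose f hf1 hf2 using fun a => nbhd_col hG hℓ a
  have hfu : ∀ u ∈ L2 G x, f (π u) u < ℓ := fun u hu => hf1 _ u (hπ u hu).2
  have hℓ0 : 0 < ℓ := by omega
  refine ColS.of_fintype (γ := Fin ℓ × Fin ℓ) _ (by simp)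
    (fun u => (⟨c u % ℓ, Nat.mod_lt _ hℓ0⟩, ⟨f (π u) u % ℓ, Nat.mod_lt _ hℓ0⟩)) ?_
  intro u hu v hv ha heq
  simp only [Prod.mk.injEq, Fin.mk.injEq] at heq
  rw [Nat.mod_eq_of_lt (hfu u hu), Nat.mod_eq_of_lt (hfu v hv),
    Nat.mod_eq_of_lt ((h1 u hu).trans_le (by omega)),
    Nat.mod_eq_of_lt ((h1 v hv).trans_le (by omega))] at heq
  by_cases hp : π u = π v
  · refine hf2 (π u) u (hπ u hu).2 v ?_ ha ?_
    · show G.Adj (π u) v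
      rw [hp]; exact (hπ v hv).2
    · rw [heq.2, hp]
  · exact h2 u hu v hv ha (fun h => hp (he h)) heq.1

lemma ball_col [Finite V] (hG : CycleLenFree G (ℓ + 1)) (hℓ : 4 ≤ ℓ) (x : V) :
    ColS G {u | ∃ a, G.Adj x a ∧ G.Adj a u} (1 + ℓ + ℓ * ℓ) := by
  have h0 : ColS G {x} 1 := ⟨fun _ => 0, by simp, by
    rintro u rfl v rfl h; exact absurd h (G.loopless.irrefl _)⟩
  refine ((h0.union (nbhd_col hG hℓ x)).union (L2_col hG hℓ x)).mono ?_ le_rfl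
  intro u hu
  by_cases h1 : u = x
  · exact Or.inl (Or.inl h1)
  by_cases h2 : G.Adj x u
  · exact Or.inl (Or.inr h2)
  exact Or.inr ⟨h1, h2, hu⟩

end cyc

section linial

lemma quad_roots {q : ℕ} [Fact q.Prime] (x y z : ZMod q) (h : ¬ (x = 0 ∧ y = 0 ∧ z = 0)) :
    (Finset.univ.filter (fun t : ZMod q => z * t ^ 2 + y * t + x = 0)).card ≤ 2 := by
  classical
  let P : Polynomial (ZMod q) := Polynomial.C z * Polynomial.X ^ 2 + Polynomial.C y * Polynomial.X
    + Polynomial.C x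
  have hP : P ≠ 0 := by
    intro h0
    apply h
    refine ⟨?_, ?_, ?_⟩
    · have := congrArg (fun p => Polynomial.coeff p 0) h0
      simpa [P] using this
    · have := congrArg (fun p => Polynomial.coeff p 1) h0
      simpa [P, Polynomial.coeff_X, Polynomial.coeff_C, Polynomial.coeff_X_pow] using this
    · have := congrArg (fun p => Polynomial.coeff p 2) h0
      simpa [P, Polynomial.coeff_X, Polynomial.coeff_C, Polynomial.coeff_X_pow] using this
  have hsub : Finset.univ.filter (fun t : ZMod q => z * t ^ 2 + y * t + x = 0)
      ⊆ P.roots.toFinset := by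
    intro t ht
    simp only [Finset.mem_filter, Finset.mem_univ, true_and] at ht
    rw [Multiset.mem_toFinset, Polynomial.mem_roots hP]
    simpa [P, Polynomial.IsRoot] using ht
  calc _ ≤ P.roots.toFinset.card := Finset.card_le_card hsub
    _ ≤ P.roots.card := Multiset.toFinset_card_le _
    _ ≤ P.natDegree := P.card_roots'
    _ ≤ 2 := Polynomial.natDegree_quadratic_le

variable {V : Type} [Fintype V] [DecidableEq V] {G : SimpleGraph V} [DecidableRel G.Adj]

lemma linial {σ : V → ℕ} (hσ : IsProperColoring G σ) {q r : ℕ} (hq : q.Prime) (hr : 2 * r < q)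
    (R : Finset V) (hsee : ∀ v ∈ R, ((R.filter (fun u => G.Adj v u)).image σ).card ≤ r)
    (hp : (R.image σ).card ≤ q ^ 3) : ColS G (R : Set V) (q ^ 2) := by
  classical
  haveI : Fact q.Prime := ⟨hq⟩
  obtain ⟨g⟩ : Nonempty ((R.image σ) ↪ (ZMod q × ZMod q × ZMod q)) := by
    apply Function.Embedding.nonempty_of_card_le
    simp only [Fintype.card_coe, Fintype.card_prod, ZMod.card]
    calc _ ≤ q ^ 3 := hp
      _ = _ := by ring
  let code : ℕ → ZMod q × ZMod q × ZMod q := fun a => if h : a ∈ R.image σ then g ⟨a, h⟩ else 0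
  have hcode : ∀ a ∈ R.image σ, ∀ b ∈ R.image σ, code a = code b → a = b := by
    intro a ha b hb h
    simp only [code, ha, hb, dif_pos] at h
    exact congrArg Subtype.val (g.injective h)
  let P : ℕ → ZMod q → ZMod q := fun a t => (code a).2.2 * t ^ 2 + (code a).2.1 * t + (code a).1
  have hroots : ∀ a ∈ R.image σ, ∀ b ∈ R.image σ, a ≠ b →
      (Finset.univ.filter (fun t => P a t = P b t)).card ≤ 2 := by
    intro a ha b hb hab
    have := quad_roots ((code a).1 - (code b).1) ((code a).2.1 - (code b).2.1)
      ((code a).2.2 - (code b).2.2) (by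
        rintro ⟨h1, h2, h3⟩
        exact hab (hcode a ha b hb (Prod.ext (sub_eq_zero.1 h1)
          (Prod.ext (sub_eq_zero.1 h2) (sub_eq_zero.1 h3)))))
    refine le_trans (Finset.card_le_card ?_) this
    intro t ht
    simp only [Finset.mem_filter, Finset.mem_univ, true_and, P] at ht ⊢
    linear_combination ht
  have hex : ∀ v, ∃ t : ZMod q, v ∈ R → ∀ u ∈ R, G.Adj v u → P (σ v) t ≠ P (σ u) t := by
    intro v
    by_cases hv : v ∈ R
    swap
    · exact ⟨0, fun h => absurd h hv⟩
    by_contra! hcon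
    have hsub : (Finset.univ : Finset (ZMod q)) ⊆
        ((R.filter (fun u => G.Adj v u)).image σ).biUnion
          (fun a => Finset.univ.filter (fun t => P (σ v) t = P a t)) := by
      intro t _
      obtain ⟨_, u, hu, ha, he⟩ := hcon t
      simp only [Finset.mem_biUnion, Finset.mem_image, Finset.mem_filter, Finset.mem_univ, true_and]
      exact ⟨σ u, ⟨u, ⟨hu, ha⟩, rfl⟩, he⟩
    have h1 := Finset.card_le_card hsub
    have h2 := Finset.card_biUnion_le_card_mul ((R.filter (fun u => G.Adj v u)).image σ)
          (fun a => Finset.univ.filter (fun t => P (σ v) t = P a t)) 2 (by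
        intro a ha
        obtain ⟨u, hu, rfl⟩ := Finset.mem_image.1 ha
        rw [Finset.mem_filter] at hu
        exact hroots _ (Finset.mem_image_of_mem _ hv) _ (Finset.mem_image_of_mem _ hu.1) (hσ hu.2))
    have h3 := hsee v hv
    rw [Finset.card_univ, ZMod.card] at h1
    omega
  choose t ht using hex
  refine ColS.of_fintype (γ := ZMod q × ZMod q) _ (by simp [ZMod.card, sq])
    (fun v => (t v, P (σ v) (t v))) ?_
  intro u hu v hv ha he
  simp only [Prod.mk.injEq] at he
  apply ht u hu v hv ha
  rw [he.2, he.1]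

lemma exists_transversal (σ : V → ℕ) (R : Finset V) :
    ∃ T ⊆ R, Set.InjOn σ T ∧ T.image σ = R.image σ := by
  classical
  obtain ⟨T, h1, h2, h3⟩ := Finset.exists_subset_injOn_image_eq_of_surjOn (f := σ)
    R (R.image σ) (by rw [Finset.coe_image]; exact Set.surjOn_image σ _)
  exact ⟨T, by exact_mod_cast h1, h2, by exact_mod_cast h3⟩

/-- rainbow independent sets in low local degree -/
lemma rainbow_indep {σ : V → ℕ} {r : ℕ}
    (R : Finset V) (hsee : ∀ v ∈ R, ((R.filter (fun u => G.Adj v u)).image σ).card ≤ r) :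
    ∃ I ⊆ R, (∀ u ∈ I, ∀ v ∈ I, ¬ G.Adj u v) ∧ (R.image σ).card ≤ (r + 1) * (I.image σ).card := by
  classical
  obtain ⟨T, hTR, hTi, hTinj⟩ : ∃ T ⊆ R, T.image σ = R.image σ ∧ Set.InjOn σ T := by
    obtain ⟨T, h1, h2, h3⟩ := exists_transversal σ R
    exact ⟨T, h1, h3, h2⟩
  have hfin : (T.powerset.filter (fun I => ∀ u ∈ I, ∀ v ∈ I, ¬ G.Adj u v)).Nonempty :=
    ⟨∅, by simp⟩
  obtain ⟨I, hI, hmax⟩ := Finset.exists_max_image _ Finset.card hfin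
  simp only [Finset.mem_filter, Finset.mem_powerset] at hI hmax
  refine ⟨I, hI.1.trans hTR, hI.2, ?_⟩
  have hIc : (I.image σ).card = I.card :=
    Finset.card_image_of_injOn (hTinj.mono (by exact_mod_cast hI.1))
  have hTc : (T.image σ).card = T.card := Finset.card_image_of_injOn hTinj
  rw [← hTi, hTc, hIc]
  have hsub : T ⊆ I.biUnion (fun i => insert i (T.filter (fun u => G.Adj i u))) := by
    intro t ht
    by_contra hcon
    simp only [Finset.mem_biUnion, Finset.mem_insert, Finset.mem_filter, not_exists, not_and,
      not_or] at hcon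
    have htI : t ∉ I := fun h => (hcon t h).1 rfl
    have := hmax (insert t I) ⟨Finset.insert_subset ht hI.1, by
      intro u hu v hv ha
      rcases Finset.mem_insert.1 hu with hu1 | hu1 <;>
        rcases Finset.mem_insert.1 hv with hv1 | hv1
      · exact ha.ne (hu1.trans hv1.symm)
      · exact (hcon v hv1).2 ht (hu1 ▸ ha.symm)
      · exact (hcon u hu1).2 ht (hv1 ▸ ha)
      · exact hI.2 u hu1 v hv1 ha⟩
    rw [Finset.card_insert_of_notMem htI] at this
    omega
  have h1 := Finset.card_le_card hsub
  have h2 := Finset.card_biUnion_le_card_mul I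
    (fun i => insert i (T.filter (fun u => G.Adj i u))) (r + 1) (by
      intro i hi
      refine (Finset.card_insert_le _ _).trans ?_
      have hh := hsee i (hTR (hI.1 hi))
      have : (T.filter (fun u => G.Adj i u)).card ≤
          ((R.filter (fun u => G.Adj i u)).image σ).card := by
        rw [← Finset.card_image_of_injOn (f := σ) (s := T.filter (fun u => G.Adj i u))
          (hTinj.mono (by intro x hx; simp at hx; exact_mod_cast hx.1))]
        exact Finset.card_le_card (Finset.image_subset_image (Finset.filter_subset_filter _ hTR))
      omega)
  calc T.card ≤ _ := h1
    _ ≤ _ := h2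
    _ = _ := by ring

/-- From many colours in a neighbourhood, an independent set with many colours. -/
lemma indep_of_col {σ : V → ℕ} {s d : ℕ} (N : Finset V) (hN : ColS G (N : Set V) s)
    (hc : s * d < (N.image σ).card) :
    ∃ Y ⊆ N, (∀ u ∈ Y, ∀ v ∈ Y, ¬ G.Adj u v) ∧ Set.InjOn σ Y ∧ Y.card = d := by
  classical
  obtain ⟨T, hTR, hTinj, hTi⟩ := exists_transversal σ N
  have hTc : (T.image σ).card = T.card := Finset.card_image_of_injOn hTinj
  obtain ⟨c, h1, h2⟩ := hN
  obtain ⟨j, hj, hlt⟩ := Finset.exists_lt_card_fiber_of_mul_lt_card_of_maps_to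
    (s := T) (t := Finset.range s) (f := c) (n := d)
    (fun v hv => Finset.mem_range.2 (h1 v (hTR hv))) (by simp; rw [← hTc, hTi]; exact hc)
  obtain ⟨Y, hY, hYd⟩ := Finset.exists_subset_card_eq hlt.le
  refine ⟨Y, fun y hy => hTR (Finset.mem_filter.1 (hY hy)).1, ?_, ?_, hYd⟩
  · intro u hu v hv ha
    have hu' := Finset.mem_filter.1 (hY hu)
    have hv' := Finset.mem_filter.1 (hY hv)
    exact h2 u (hTR hu'.1) v (hTR hv'.1) ha (hu'.2.trans hv'.2.symm)
  · exact hTinj.mono (fun y hy => (Finset.mem_filter.1 (hY hy)).1)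

end linial

section step
variable {V : Type} [Fintype V] [DecidableEq V] {G : SimpleGraph V} [DecidableRel G.Adj]

lemma exists_tenth_root (n : ℕ) : ∃ m : ℕ, m ^ 10 ≤ n ∧ n < (m + 1) ^ 10 := by
  by_contra! h
  have : ∀ m : ℕ, m ^ 10 ≤ n := by
    intro m
    induction m with
    | zero => simp
    | succ m ih => exact h m ih
  have h1 := this (n + 1)
  have h2 : n + 1 ≤ (n + 1) ^ 10 := Nat.le_self_pow (by norm_num) _
  omega

/-- The threshold constant. -/
def thr (ℓ : ℕ) : ℕ := 1024 * (1 + ℓ + ℓ * ℓ + ℓ ^ 2)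

lemma step {ℓ : ℕ} (hG : CycleLenFree G (ℓ + 1)) (hℓ : 4 ≤ ℓ) {σ : V → ℕ}
    (hσ : IsProperColoring G σ) (W : Finset V) (n : ℕ)
    (hK : thr ℓ ^ 10 ≤ n) :
    ∃ Y ⊆ W, (∀ u ∈ Y, ∀ v ∈ Y, ¬ G.Adj u v) ∧ (n ≤ (Y.image σ).card ∨
      ∃ n', ColS G (W.filter (fun v => σ v ∉ Y.image σ) : Set V) n' ∧ n' ^ 10 ≤ n ^ 9) := by
  classical
  obtain ⟨m, hm1, hm2⟩ := exists_tenth_root n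
  have hMm : thr ℓ ≤ m := by
    by_contra! h
    have h1 : (m + 1) ^ 10 ≤ (thr ℓ) ^ 10 := Nat.pow_le_pow_left h 10
    omega
  have hm0 : 1 ≤ m := by unfold thr at hMm; omega
  have hn10 : n < 1024 * m ^ 10 := by
    have h1 : (m + 1) ^ 10 ≤ (2 * m) ^ 10 := Nat.pow_le_pow_left (by omega) 10
    rw [mul_pow] at h1
    norm_num at h1
    omega
  let Q : Finset V → Prop := fun Y => Y ⊆ W ∧ (∀ u ∈ Y, ∀ v ∈ Y, ¬ G.Adj u v) ∧ Set.InjOn σ Y ∧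
    ∃ X : Finset V, (∀ y ∈ Y, ∃ x ∈ X, G.Adj x y) ∧ X.card * m ^ 2 ≤ Y.card
  have hfin : (Finset.univ.filter Q).Nonempty := by
    refine ⟨∅, ?_⟩
    simp only [Finset.mem_filter, Finset.mem_univ, true_and, Q]
    exact ⟨by simp, by simp, by simp, ∅, by simp, by simp⟩
  obtain ⟨Y, hY, hmax⟩ := Finset.exists_max_image _ Finset.card hfin
  simp only [Finset.mem_filter, Finset.mem_univ, true_and] at hY hmax
  obtain ⟨hYW, hYi, hYinj, X, hXY, hXc⟩ := hY
  have hYc : (Y.image σ).card = Y.card := Finset.card_image_of_injOn hYinj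
  by_cases hk : n ≤ Y.card
  · exact ⟨Y, hYW, hYi, Or.inl (hYc ▸ hk)⟩
  set R := W.filter (fun v => σ v ∉ Y.image σ) with hR
  set R2 := R.filter (fun v => ∀ y ∈ Y, ¬ G.Adj y v) with hR2
  -- every vertex sees few colours in R2
  have hsee : ∀ v ∈ R2, ((R2.filter (fun u => G.Adj v u)).image σ).card ≤ ℓ * m ^ 2 := by
    intro v _
    by_contra! hcon
    obtain ⟨Z, hZN, hZi, hZinj, hZc⟩ := indep_of_col (G := G) (s := ℓ) (d := m ^ 2)
      (R2.filter (fun u => G.Adj v u))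
      ((nbhd_col hG hℓ v).mono (by intro u hu; simp at hu; exact hu.2) le_rfl) hcon
    have hZ : ∀ z ∈ Z, z ∈ W ∧ σ z ∉ Y.image σ ∧ (∀ y ∈ Y, ¬ G.Adj y z) ∧ G.Adj v z := by
      intro z hz
      have := hZN hz
      rw [Finset.mem_filter, hR2, Finset.mem_filter, hR, Finset.mem_filter] at this
      exact ⟨this.1.1.1, this.1.1.2, this.1.2, this.2⟩
    have hdisj : Disjoint Y Z := by
      rw [Finset.disjoint_left]
      intro y hy hz
      exact (hZ y hz).2.1 (Finset.mem_image_of_mem _ hy)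
    have hQ : Q (Y ∪ Z) := by
      refine ⟨Finset.union_subset hYW (fun z hz => (hZ z hz).1), ?_, ?_, insert v X, ?_, ?_⟩
      · intro a ha b hb hab
        rcases Finset.mem_union.1 ha with ha | ha <;> rcases Finset.mem_union.1 hb with hb | hb
        · exact hYi a ha b hb hab
        · exact (hZ b hb).2.2.1 a ha hab
        · exact (hZ a ha).2.2.1 b hb hab.symm
        · exact hZi a ha b hb hab
      · intro a ha b hb hab
        rcases Finset.mem_union.1 (Finset.mem_coe.1 ha) with ha | ha <;>
          rcases Finset.mem_union.1 (Finset.mem_coe.1 hb) with hb | hb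
        · exact hYinj ha hb hab
        · exact absurd (hab ▸ Finset.mem_image_of_mem σ ha) (hZ b hb).2.1
        · exact absurd (hab ▸ Finset.mem_image_of_mem σ hb) (hZ a ha).2.1
        · exact hZinj ha hb hab
      · intro y hy
        rcases Finset.mem_union.1 hy with hy | hy
        · obtain ⟨x, hx, hxy⟩ := hXY y hy
          exact ⟨x, Finset.mem_insert_of_mem hx, hxy⟩
        · exact ⟨v, Finset.mem_insert_self _ _, (hZ y hy).2.2.2⟩
      · rw [Finset.card_union_of_disjoint hdisj, hZc]
        calc (insert v X).card * m ^ 2 ≤ (X.card + 1) * m ^ 2 :=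
              Nat.mul_le_mul_right _ (Finset.card_insert_le _ _)
          _ = X.card * m ^ 2 + m ^ 2 := by ring
          _ ≤ _ := by omega
    have := hmax _ hQ
    rw [Finset.card_union_of_disjoint hdisj, hZc] at this
    have : 0 < m ^ 2 := by positivity
    omega
  obtain ⟨I, hIR, hIi, hIc⟩ := rainbow_indep (G := G) R2 hsee
  have hR2W : R2 ⊆ W := (Finset.filter_subset _ _).trans (Finset.filter_subset _ _)
  by_cases hIn : n ≤ (I.image σ).card
  · exact ⟨I, hIR.trans hR2W, hIi, Or.inl hIn⟩
  refine ⟨Y, hYW, hYi, Or.inr ?_⟩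
  have ht0 : 16 * ℓ * m ^ 4 ≠ 0 := by
    have : 0 < ℓ := by omega
    positivity
  obtain ⟨q, hqp, hq1, hq2⟩ := Nat.exists_prime_lt_and_le_two_mul (16 * ℓ * m ^ 4) ht0
  have hmm : m ^ 2 ≤ m ^ 4 := Nat.pow_le_pow_right hm0 (by norm_num)
  have hcol2 : ColS G (R2 : Set V) (q ^ 2) := by
    refine linial hσ hqp (r := ℓ * m ^ 2) ?_ R2 hsee ?_
    · have : ℓ * m ^ 2 ≤ ℓ * m ^ 4 := Nat.mul_le_mul_left _ hmm
      nlinarith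
    · have h1 : 1 ≤ ℓ * m ^ 2 := Nat.one_le_iff_ne_zero.2 (by
        have : 0 < ℓ := by omega
        positivity)
      have h2 : ℓ ≤ ℓ ^ 3 := Nat.le_self_pow (by norm_num) _
      calc (R2.image σ).card ≤ (ℓ * m ^ 2 + 1) * (I.image σ).card := hIc
        _ ≤ (2 * (ℓ * m ^ 2)) * (1024 * m ^ 10) := Nat.mul_le_mul (by omega) (by omega)
        _ = 2048 * m ^ 12 * ℓ := by ring
        _ ≤ 4096 * m ^ 12 * ℓ ^ 3 := Nat.mul_le_mul (Nat.mul_le_mul_right _ (by norm_num)) h2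
        _ = (16 * ℓ * m ^ 4) ^ 3 := by ring
        _ ≤ q ^ 3 := Nat.pow_le_pow_left hq1.le 3
  have hcol1 := ColS.biUnion (fun x => {u | ∃ a, G.Adj x a ∧ G.Adj a u})
    (fun x => ball_col hG hℓ x) X
  have hcol := hcol1.union hcol2
  refine ⟨_, hcol.mono ?_ le_rfl, ?_⟩
  · intro v hv
    rw [← hR] at hv
    by_cases h : ∀ y ∈ Y, ¬ G.Adj y v
    · exact Or.inr (Finset.mem_coe.2 (Finset.mem_filter.2 ⟨hv, h⟩))
    · push Not at h
      obtain ⟨y, hy, hyv⟩ := h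
      obtain ⟨x, hx, hxy⟩ := hXY y hy
      exact Or.inl ⟨x, hx, y, hxy, hyv⟩
  · have hX8 : X.card ≤ 1024 * m ^ 8 := by
      have h1 : X.card * m ^ 2 ≤ (1024 * m ^ 8) * m ^ 2 := by
        calc X.card * m ^ 2 ≤ 1024 * m ^ 10 := by omega
          _ = _ := by ring
      exact Nat.le_of_mul_le_mul_right h1 (by positivity)
    have hle : X.card * (1 + ℓ + ℓ * ℓ) + q ^ 2 ≤ m ^ 9 := by
      calc X.card * (1 + ℓ + ℓ * ℓ) + q ^ 2
          ≤ (1024 * m ^ 8) * (1 + ℓ + ℓ * ℓ) + (2 * (16 * ℓ * m ^ 4)) ^ 2 :=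
            Nat.add_le_add (Nat.mul_le_mul_right _ hX8) (Nat.pow_le_pow_left hq2 2)
        _ = thr ℓ * m ^ 8 := by unfold thr; ring
        _ ≤ m * m ^ 8 := Nat.mul_le_mul_right _ hMm
        _ = m ^ 9 := by ring
    calc _ ≤ (m ^ 9) ^ 10 := Nat.pow_le_pow_left hle 10
      _ = (m ^ 10) ^ 9 := by ring
      _ ≤ n ^ 9 := Nat.pow_le_pow_left hm1 9

lemma main_ind {ℓ : ℕ} (hG : CycleLenFree G (ℓ + 1)) (hℓ : 4 ≤ ℓ) {σ : V → ℕ}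
    (hσ : IsProperColoring G σ) (j : ℕ) : ∀ (W : Finset V) (n : ℕ),
    chromNum (G.induce (W : Set V)) = n →
    Real.log n ≤ (10 / 9 : ℝ) ^ j * Real.log (thr ℓ ^ 10 : ℕ) →
    ∃ S ⊆ W, ∃ t, ColS G (S : Set V) t ∧ n + t ≤ (S.image σ).card + thr ℓ ^ 10 + j := by
  classical
  have hsmall : ∀ (W : Finset V) (n j : ℕ), n ≤ thr ℓ ^ 10 →
      ∃ S ⊆ W, ∃ t, ColS G (S : Set V) t ∧ n + t ≤ (S.image σ).card + thr ℓ ^ 10 + j := by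
    intro W n j hn
    exact ⟨∅, by simp, 0, by simpa using ColS.empty, by simp; omega⟩
  induction j with
  | zero =>
    intro W n hn hlog
    apply hsmall
    by_contra! h
    have h0 : (0 : ℝ) < (thr ℓ ^ 10 : ℕ) := by
      have : 0 < thr ℓ := by unfold thr; omega
      exact_mod_cast pow_pos this 10
    have := Real.log_lt_log h0 (Nat.cast_lt (α := ℝ).2 h)
    simp only [pow_zero, one_mul] at hlog
    linarith
  | succ j ih =>
    intro W n hn hlog
    by_cases hle : n ≤ thr ℓ ^ 10
    · exact hsmall W n _ hle
    push Not at hle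
    obtain ⟨Y, hYW, hYi, hY⟩ := step hG hℓ hσ W n hle.le
    have hYcol : ColS G (Y : Set V) 1 :=
      ⟨fun _ => 0, by simp, fun u hu v hv ha => absurd ha (hYi u hu v hv)⟩
    rcases hY with hY | ⟨n', hn', hpow⟩
    · exact ⟨Y, hYW, 1, hYcol, by omega⟩
    set W' := W.filter (fun v => σ v ∉ Y.image σ) with hW'
    have hcW' : ColS G (W' : Set V) n' := hn'.mono (by intro v hv; simpa [hW'] using hv) le_rfl
    obtain ⟨n'', hn''⟩ : ∃ a, chromNum (G.induce (W' : Set V)) = a := ⟨_, rfl⟩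
    have hle'' : n'' ≤ n' := hn'' ▸ chromNum_induce_le.2 hcW'
    obtain ⟨S, hSW, t, hSt, hS⟩ := ih W' n'' hn'' (by
      have h1 : (n'' : ℝ) ^ 10 ≤ (n : ℝ) ^ 9 := by
        exact_mod_cast (Nat.pow_le_pow_left hle'' 10).trans hpow
      have hn0 : (1 : ℝ) ≤ n := by exact_mod_cast (by omega : 1 ≤ n)
      have h2 : 10 * Real.log n'' ≤ 9 * Real.log n := by
        rcases Nat.eq_zero_or_pos n'' with h | h
        · rw [h]; simp; exact Real.log_nonneg hn0
        · have := Real.log_le_log (by positivity) h1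
          rw [Real.log_pow, Real.log_pow] at this
          exact_mod_cast this
      rw [pow_succ] at hlog
      linarith)
    have hWcol : ColS G (W : Set V) ((Y.image σ).card + n'') := by
      have ha : ColS G {v | σ v ∈ Y.image σ} (Y.image σ).card :=
        ColS.of_proper hσ _ (fun v hv => hv)
      refine (ha.union (chromNum_induce_le.1 hn''.le)).mono ?_ le_rfl
      intro v hv
      by_cases h : σ v ∈ Y.image σ
      · exact Or.inl h
      · exact Or.inr (Finset.mem_coe.2 (Finset.mem_filter.2 ⟨hv, h⟩))
    have hnle : n ≤ (Y.image σ).card + n'' := hn ▸ chromNum_induce_le.2 hWcol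
    refine ⟨Y ∪ S, Finset.union_subset hYW (hSW.trans (Finset.filter_subset _ _)), 1 + t, ?_, ?_⟩
    · rw [Finset.coe_union]; exact hYcol.union hSt
    · rw [Finset.image_union, Finset.card_union_of_disjoint]
      · omega
      · rw [Finset.disjoint_left]
        intro a ha hs
        obtain ⟨s, hsS, rfl⟩ := Finset.mem_image.1 hs
        exact (Finset.mem_filter.1 (hSW hsS)).2 ha

end step

lemma chromDisc_ge {V : Type} [Fintype V] (G : SimpleGraph V) (z : ℤ)
    (h : ∀ σ : V → ℕ, IsProperColoring G σ → ∃ S : Finset V, ∃ t : ℕ, ColS G (S : Set V) t ∧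
      z + t ≤ (S.image σ).card) : z ≤ chromDisc G := by
  classical
  apply le_csInf
  · obtain ⟨e, he⟩ := Countable.exists_injective_nat V
    exact ⟨_, e, fun u v ha h => ha.ne (he h), rfl⟩
  · rintro _ ⟨σ, hσ, rfl⟩
    obtain ⟨S, t, hS, hz⟩ := h σ hσ
    have hb : BddAbove {z : ℤ | ∃ S : Set V,
        z = ((σ '' S).ncard : ℤ) - (chromNum (G.induce S) : ℤ)} := by
      refine ⟨Fintype.card V, ?_⟩
      rintro _ ⟨S, rfl⟩
      have h1 : (σ '' S).ncard ≤ S.ncard := Set.ncard_image_le S.toFinite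
      have h2 : S.ncard ≤ Nat.card V := Set.ncard_le_card S
      rw [Nat.card_eq_fintype_card] at h2
      have : ((σ '' S).ncard : ℤ) ≤ Fintype.card V := by exact_mod_cast h1.trans h2
      omega
    refine le_trans ?_ (le_csSup hb ⟨(S : Set V), rfl⟩)
    have h1 : chromNum (G.induce (S : Set V)) ≤ t := chromNum_induce_le.2 hS
    rw [← Finset.coe_image, Set.ncard_coe_finset]
    omega

/-- For every integer `ℓ ≥ 4` there exists a constant `c_ℓ` such that
every finite `C_{ℓ+1}`-free simple graph `G` with at least one vertex satisfies
`φ(G) ≥ χ(G) - 8ℓ²·ln(ln(χ(G))) - c_ℓ`. -/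
theorem cycleFree_chromDisc (ℓ : ℕ) (hℓ : 4 ≤ ℓ) :
    ∃ c : ℝ, ∀ (V : Type) [Fintype V] [Nonempty V] (G : SimpleGraph V),
      CycleLenFree G (ℓ + 1) →
      (chromDisc G : ℝ) ≥
        (chromNum G : ℝ) - 8 * ℓ ^ 2 * Real.log (Real.log (chromNum G)) - c := by
  classical
  set K : ℕ := thr ℓ ^ 10 with hKdef
  refine ⟨K + 1 + 8 * ℓ ^ 2, ?_⟩
  intro V _ _ G hG
  obtain ⟨n, hn⟩ : ∃ n, chromNum G = n := ⟨_, rfl⟩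
  obtain ⟨N, hN⟩ : ∃ N, chromNum (G.induce ((Finset.univ : Finset V) : Set V)) = N := ⟨_, rfl⟩
  have hnN : n ≤ N := by
    rw [← hn, ← hN, Finset.coe_univ]; exact chromNum_le_univ
  have hNn : N ≤ n := by
    rw [← hN, chromNum_induce_le, ← hn]
    have hmem : G.Colorable (chromNum G) :=
      Nat.sInf_mem (s := {n : ℕ | G.Colorable n}) ⟨_, G.colorable_of_fintype⟩
    obtain ⟨C⟩ := hmem
    exact ⟨fun v => (C v : ℕ), fun v _ => (C v).2, fun u _ v _ ha he => C.valid ha (Fin.ext he)⟩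
  have hNeq : N = n := le_antisymm hNn hnN
  subst hNeq
  rw [hn]
  have key : ∀ j : ℕ, Real.log N ≤ (10 / 9 : ℝ) ^ j * Real.log (K : ℕ) →
      (N : ℝ) - K - j ≤ chromDisc G := by
    intro j hj
    have : ((N : ℤ) - K - j) ≤ chromDisc G := by
      apply chromDisc_ge
      intro σ hσ
      obtain ⟨S, -, t, hS, h⟩ := main_ind hG hℓ hσ j Finset.univ N hN hj
      refine ⟨S, t, hS, ?_⟩
      rw [← hKdef] at h
      omega
    exact_mod_cast this
  have hK3 : 3 ≤ K := by
    have h1 : 3 ≤ thr ℓ := by unfold thr; omega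
    exact h1.trans (Nat.le_self_pow (by norm_num) _)
  have hlogK : 1 ≤ Real.log K := by
    have h3 : Real.exp 1 ≤ K := by
      have : (3 : ℝ) ≤ K := by exact_mod_cast hK3
      linarith [Real.exp_one_lt_d9]
    rw [Real.le_log_iff_exp_le (by positivity)]
    exact h3
  have hℓ0 : (0 : ℝ) ≤ 8 * (ℓ : ℝ) ^ 2 := by positivity
  have hℓ4 : (128 : ℝ) ≤ 8 * (ℓ : ℝ) ^ 2 := by
    have : (4 : ℝ) ≤ ℓ := by exact_mod_cast hℓ
    nlinarith
  by_cases hsmall : N ≤ K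
  · have h0 := key 0 (by
      simp only [pow_zero, one_mul]
      rcases Nat.eq_zero_or_pos N with h | h
      · rw [h]; simp; linarith
      · exact Real.log_le_log (by exact_mod_cast h) (by exact_mod_cast hsmall))
    have hll : -1 ≤ Real.log (Real.log N) := by
      rcases Nat.lt_or_ge N 2 with h | h
      · interval_cases N <;> simp
      · have h2 : (1 / 2 : ℝ) ≤ Real.log N := by
          have : Real.log 2 ≤ Real.log N := Real.log_le_log (by norm_num) (by exact_mod_cast h)
          linarith [Real.log_two_gt_d9]
        rw [Real.le_log_iff_exp_le (by linarith)]
        have h3 : Real.exp (-1) ≤ 1 / 2 := by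
          rw [Real.exp_neg, inv_eq_one_div]
          apply one_div_le_one_div_of_le (by norm_num)
          linarith [Real.exp_one_gt_d9]
        linarith
    push_cast at h0
    nlinarith
  · push Not at hsmall
    have hlogN : Real.log K ≤ Real.log N :=
      Real.log_le_log (by positivity) (by exact_mod_cast hsmall.le)
    have hLL : 0 ≤ Real.log (Real.log N) := Real.log_nonneg (by linarith)
    set x := Real.log (Real.log N) with hx
    have hj := Nat.ceil_lt_add_one (a := 10 * x) (by positivity)
    have hj' := Nat.le_ceil (10 * x)
    have h0 := key ⌈10 * x⌉₊ (by
      have h109 : (1 / 10 : ℝ) ≤ Real.log (10 / 9) := by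
        have := Real.one_sub_inv_le_log_of_pos (x := (10 / 9 : ℝ)) (by norm_num)
        norm_num at this ⊢
        linarith
      have h1 : Real.log N ≤ (10 / 9 : ℝ) ^ ⌈10 * x⌉₊ := by
        rw [← Real.log_le_log_iff (by linarith) (by positivity), Real.log_pow]
        rw [← hx]
        have : (0 : ℝ) ≤ (⌈10 * x⌉₊ : ℝ) := Nat.cast_nonneg _
        nlinarith
      have h2 : (0 : ℝ) ≤ (10 / 9 : ℝ) ^ ⌈10 * x⌉₊ := by positivity
      nlinarith)
    nlinarith
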